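/- Let B be a perfect basis of V. Then B⁺ = B ∩ V⁺ is a basis of the subspace V⁺ = ⋂_{i∈I} ker eᵢ of highest weight vectors; in particular, V⁺ is the ℂ-linear span of those elements of B that are annihilated by all the operators eᵢ. -/

import Mathlib

variable {I : Type*} {Λ : Type*} [AddCommGroup Λ]
variable {V : Type*} [AddCommGroup V] [Module ℂ V]

/-- For a linear endomorphism `f` and a vector `v`, `ell f v` is
`ℓ(v) = max{ℓ ≥ 0 : f^ℓ(v) ≠ 0}` (a junk value if the set is empty or unbounded). -/
noncomputable def ell (f : Module.End ℂ V) (v : V) : ℕ :=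
  sSup {l : ℕ | (f ^ l) v ≠ 0}

/-- `e^top(v) = f^{ℓ(v)}(v)`. -/
noncomputable def etop1 (f : Module.End ℂ V) (v : V) : V := (f ^ ell f v) v

/-- For a sequence `𝐢 = (i₁, …, i_m)`, `e_𝐢^top = e_{i_m}^top ∘ ⋯ ∘ e_{i₁}^top`. -/
noncomputable def etopSeq (e : I → Module.End ℂ V) : List I → V → V
  | [], v => v
  | i :: t, v => etopSeq e t (etop1 (e i) v)

/-- The preorder `≼_𝐢` on nonzero vectors attached to a sequence `𝐢`:
for `𝐢 = (i)`, `v ≼ v'` iff `ℓᵢ(v) ≤ ℓᵢ(v')`; for `𝐢 = (i, 𝐢')`, `v ≼ v'` iff either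
`ℓᵢ(v) < ℓᵢ(v')`, or `ℓᵢ(v) = ℓᵢ(v')` and `eᵢ^{ℓᵢ(v)}(v) ≼_{𝐢'} eᵢ^{ℓᵢ(v)}(v')`. -/
def PreOrdSeq (e : I → Module.End ℂ V) : List I → V → V → Prop
  | [], _, _ => True
  | i :: t, v, v' =>
      ell (e i) v < ell (e i) v' ∨
      (ell (e i) v = ell (e i) v' ∧
        PreOrdSeq e t ((e i ^ ell (e i) v) v) ((e i ^ ell (e i) v) v'))

/-- The equivalence relation `≡_𝐢`: `v ≼_𝐢 v'` and `v' ≼_𝐢 v`. -/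
def EquivSeq (e : I → Module.End ℂ V) (ii : List I) (v v' : V) : Prop :=
  PreOrdSeq e ii v v' ∧ PreOrdSeq e ii v' v

/-- The strict relation `≺_𝐢`, with the convention `0 ≺_𝐢 v'` for every nonzero `v'`. -/
def PrecSeq (e : I → Module.End ℂ V) (ii : List I) (v v' : V) : Prop :=
  v = 0 ∨ (PreOrdSeq e ii v v' ∧ ¬ PreOrdSeq e ii v' v)

/-- Local finiteness: every vector lies in a finite-dimensional subspace invariant
under all the operators `e i`. -/
def IsLocallyFiniteFamily (e : I → Module.End ℂ V) : Prop :=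
  ∀ v : V, ∃ W : Submodule ℂ V, FiniteDimensional ℂ W ∧ v ∈ W ∧
    ∀ i, Submodule.map (e i) W ≤ W

/-- A perfect basis of `V` (with respect to the weight decomposition `Vμ` and the
operators `e i`): a weight basis `carrier` together with partial bijections
`ẽᵢ : carrier → carrier` (encoded by total maps `et i`, with domain
`{b : e i b ≠ 0}`) such that `eᵢ(b) ∈ ℂ^×·ẽᵢ(b) + Vᵢ^{<ℓᵢ(b)−1}` whenever
`eᵢ(b) ≠ 0`. -/
structure PerfectBasis (Vμ : Λ → Submodule ℂ V) (e : I → Module.End ℂ V) where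
  carrier : Set V
  indep : LinearIndependent ℂ ((↑) : carrier → V)
  spans : Submodule.span ℂ carrier = ⊤
  weight : ∀ b ∈ carrier, ∃ μ, b ∈ Vμ μ
  et : I → V → V
  et_mem : ∀ i, ∀ b ∈ carrier, e i b ≠ 0 → et i b ∈ carrier
  et_inj : ∀ i, ∀ b ∈ carrier, ∀ b' ∈ carrier,
      e i b ≠ 0 → e i b' ≠ 0 → et i b = et i b' → b = b'
  et_approx : ∀ i, ∀ b ∈ carrier, e i b ≠ 0 →
      ∃ c : ℂ, c ≠ 0 ∧ (e i ^ (ell (e i) b - 1)) (e i b - c • et i b) = 0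

lemma ell_eq_of_pow {f : Module.End ℂ V} {v : V} {n : ℕ} (h : (f ^ n) v ≠ 0)
    (h' : (f ^ (n + 1)) v = 0) : ell f v = n := by
  refine IsGreatest.csSup_eq ⟨h, fun m hm => ?_⟩
  by_contra! hlt
  exact hm (Module.End.pow_map_zero_of_le hlt h')

/-- On vectors where `f` is not nilpotent, `ell` takes its junk value. -/
lemma ell_eq_zero_of_forall_pow_ne {f : Module.End ℂ V} {v : V} (h : ∀ m, (f ^ m) v ≠ 0) :
    ell f v = 0 := by
  have huniv : {l : ℕ | (f ^ l) v ≠ 0} = Set.univ := Set.eq_univ_of_forall h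
  rw [ell, huniv]
  exact Nat.sSup_of_not_bddAbove not_bddAbove_univ

/-- Either `n` is the largest exponent with `fⁿ v ≠ 0`, or no power of `f` kills `v`. -/
def IsTopExponent (f : Module.End ℂ V) (n : ℕ) (v : V) : Prop :=
  (f ^ n) v ≠ 0 ∧ ((f ^ (n + 1)) v = 0 ∨ ∀ m, (f ^ m) v ≠ 0)

lemma IsTopExponent.map_ne_zero {f : Module.End ℂ V} {n : ℕ} {v : V}
    (h : IsTopExponent f (n + 1) v) : f v ≠ 0 := by
  intro h0
  apply h.1
  rw [pow_succ, Module.End.mul_apply, h0, map_zero]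

lemma IsTopExponent.step {f : Module.End ℂ V} {n : ℕ} {v w : V} {c : ℂ}
    (h : IsTopExponent f (n + 1) v) (hc : c ≠ 0)
    (hw : (f ^ (ell f v - 1)) (f v - c • w) = 0) :
    IsTopExponent f n w ∧ (f ^ (n + 1)) v = c • (f ^ n) w := by
  obtain ⟨hne, htop | hinf⟩ := h
  · rw [ell_eq_of_pow hne htop, Nat.add_sub_cancel, map_sub, map_smul, sub_eq_zero,
      ← Module.End.mul_apply, ← pow_succ] at hw
    refine ⟨⟨fun h0 => hne (by rw [hw, h0, smul_zero]), Or.inl ?_⟩, hw⟩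
    rw [pow_succ', Module.End.mul_apply, hw, map_smul, ← Module.End.mul_apply,
      ← pow_succ'] at htop
    exact (smul_eq_zero.mp htop).resolve_left hc
  · rw [ell_eq_zero_of_forall_pow_ne hinf, Nat.zero_sub, pow_zero, Module.End.one_apply,
      sub_eq_zero] at hw
    have hpow (m : ℕ) : (f ^ (m + 1)) v = c • (f ^ m) w := by
      rw [pow_succ, Module.End.mul_apply, hw, map_smul]
    have hinf' (m : ℕ) : (f ^ m) w ≠ 0 := fun h0 =>
      hinf (m + 1) (by rw [hpow, h0, smul_zero])
    exact ⟨⟨hinf' n, Or.inr hinf'⟩, hpow n⟩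

section SingleOperator

variable {ι : Type*} {b : Module.Basis ι ℂ V} {f : Module.End ℂ V} {t : ι → ι}

lemma exists_pow_eq_smul_iterate
    (happ : ∀ x, f (b x) ≠ 0 →
      ∃ c : ℂ, c ≠ 0 ∧ (f ^ (ell f (b x) - 1)) (f (b x) - c • b (t x)) = 0)
    (n : ℕ) (x : ι) (hx : IsTopExponent f n (b x)) :
    ∃ c : ℂˣ, (f ^ n) (b x) = c • b (t^[n] x) := by
  induction n generalizing x with
  | zero => exact ⟨1, by simp⟩
  | succ n ih =>
    obtain ⟨c, hc, h⟩ := happ x hx.map_ne_zero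
    obtain ⟨htop, hpow⟩ := hx.step hc h
    obtain ⟨d, hd⟩ := ih (t x) htop
    exact ⟨Units.mk0 c hc * d, by
      rw [hpow, hd, Function.iterate_succ_apply, mul_smul, Units.smul_mk0]⟩

lemma injOn_iterate_of_isTopExponent
    (hinj : Set.InjOn t {x | f (b x) ≠ 0})
    (happ : ∀ x, f (b x) ≠ 0 →
      ∃ c : ℂ, c ≠ 0 ∧ (f ^ (ell f (b x) - 1)) (f (b x) - c • b (t x)) = 0)
    (n : ℕ) : Set.InjOn t^[n] {x | IsTopExponent f n (b x)} := by
  induction n with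
  | zero => exact Function.injective_id.injOn
  | succ n ih =>
    refine ih.comp (hinj.mono fun x hx => IsTopExponent.map_ne_zero hx) fun x hx => ?_
    obtain ⟨c, hc, h⟩ := happ x (IsTopExponent.map_ne_zero hx)
    exact (IsTopExponent.step hx hc h).1

lemma linearIndepOn_pow_of_isTopExponent
    (hinj : Set.InjOn t {x | f (b x) ≠ 0})
    (happ : ∀ x, f (b x) ≠ 0 →
      ∃ c : ℂ, c ≠ 0 ∧ (f ^ (ell f (b x) - 1)) (f (b x) - c • b (t x)) = 0)
    (n : ℕ) :
    LinearIndepOn ℂ (fun x => (f ^ n) (b x)) {x | IsTopExponent f n (b x)} := by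
  choose c hc using fun x : {x | IsTopExponent f n (b x)} =>
    exists_pow_eq_smul_iterate happ n x x.2
  have hli := (b.linearIndependent.comp (fun x : {x | IsTopExponent f n (b x)} => t^[n] x)
    (injOn_iterate_of_isTopExponent hinj happ n).injective).units_smul c
  rw [LinearIndepOn, funext hc]
  exact hli

/-- A basis on which `f` acts as in a perfect basis is compatible with the kernel of `f`. -/
lemma map_basis_eq_zero_of_mem_support
    (hinj : Set.InjOn t {x | f (b x) ≠ 0})
    (happ : ∀ x, f (b x) ≠ 0 →
      ∃ c : ℂ, c ≠ 0 ∧ (f ^ (ell f (b x) - 1)) (f (b x) - c • b (t x)) = 0)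
    {v : V} (hv : f v = 0) : ∀ x ∈ (b.repr v).support, f (b x) = 0 := by
  classical
  have hdescent (n : ℕ)
      (h : ∀ x ∈ (b.repr v).support, (f ^ (n + 2)) (b x) = 0 ∨ ∀ m, (f ^ m) (b x) ≠ 0) :
      ∀ x ∈ (b.repr v).support, (f ^ (n + 1)) (b x) = 0 := by
    intro x hx
    by_contra hne
    have hsum : ∑ y ∈ (b.repr v).support with (f ^ (n + 1)) (b y) ≠ 0,
        b.repr v y • (f ^ (n + 1)) (b y) = 0 := by
      rw [Finset.sum_filter_of_ne fun y _ hy => right_ne_zero_of_smul hy]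
      have hrepr := congrArg (f ^ (n + 1)) (b.linearCombination_repr v)
      rw [Finsupp.linearCombination_apply, Finsupp.sum, map_sum] at hrepr
      simp only [map_smul] at hrepr
      rw [hrepr, pow_succ, Module.End.mul_apply, hv, map_zero]
    refine Finsupp.mem_support_iff.mp hx
      (linearIndepOn_iff'.mp (linearIndepOn_pow_of_isTopExponent hinj happ (n + 1)) _ _
        (fun y hy => ?_) hsum x (Finset.mem_filter.mpr ⟨hx, hne⟩))
    obtain ⟨hy, hyne⟩ := Finset.mem_filter.mp hy
    exact ⟨hyne, h y hy⟩
  have hinduct (n : ℕ)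
      (h : ∀ x ∈ (b.repr v).support, (f ^ (n + 2)) (b x) = 0 ∨ ∀ m, (f ^ m) (b x) ≠ 0) :
      ∀ x ∈ (b.repr v).support, f (b x) = 0 := by
    induction n with
    | zero => simpa using hdescent 0 h
    | succ n ih => exact ih fun x hx => Or.inl (hdescent (n + 1) h x hx)
  have hexp (x : ι) : ∃ N, (f ^ N) (b x) = 0 ∨ ∀ m, (f ^ m) (b x) ≠ 0 := by
    by_cases h : ∃ N, (f ^ N) (b x) = 0
    · exact h.imp fun _ => Or.inl
    · exact ⟨0, Or.inr (not_exists.mp h)⟩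
  choose N hN using hexp
  refine hinduct ((b.repr v).support.sup N) fun x hx => (hN x).imp_left ?_
  exact Module.End.pow_map_zero_of_le ((Finset.le_sup hx).trans (Nat.le_add_right _ 2))

end SingleOperator

/-- Let `B` be a perfect basis of a locally finite module `V`.  Then
`B⁺ = B ∩ V⁺` is a basis of the subspace `V⁺ = ⋂ᵢ ker eᵢ` of highest weight vectors:
it is linearly independent (being a subset of `B`) and its span is `V⁺`. -/
theorem perfectBasis_highest_weight_basis
    {I : Type*} [Finite I] {Λ : Type*} [AddCommGroup Λ]
    [Module.Free ℤ Λ] [Module.Finite ℤ Λ] [DecidableEq Λ]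
    {V : Type*} [AddCommGroup V] [Module ℂ V]
    (αv : I → Λ) (Vμ : Λ → Submodule ℂ V) (hdecomp : DirectSum.IsInternal Vμ)
    (e : I → Module.End ℂ V)
    (hshift : ∀ i μ, Submodule.map (e i) (Vμ μ) ≤ Vμ (μ + αv i))
    (hlf : IsLocallyFiniteFamily e)
    (PB : PerfectBasis Vμ e) :
    LinearIndependent ℂ
      ((↑) : (PB.carrier ∩ {v : V | ∀ i, e i v = 0} : Set V) → V) ∧
    Submodule.span ℂ (PB.carrier ∩ {v : V | ∀ i, e i v = 0}) =
      ⨅ i, LinearMap.ker (e i) := by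
  refine ⟨LinearIndepOn.mono (v := id) PB.indep Set.inter_subset_left, le_antisymm ?_ fun v hv => ?_⟩
  · refine Submodule.span_le.mpr fun v hv => ?_
    simpa using hv.2
  · classical
    let b : Module.Basis PB.carrier ℂ V :=
      Module.Basis.mk PB.indep (by rw [Subtype.range_coe, PB.spans])
    have hb (x : PB.carrier) : b x = x := Module.Basis.mk_apply ..
    have hker (x : PB.carrier) (hx : x ∈ (b.repr v).support) (i : I) : e i x = 0 := by
      let t : PB.carrier → PB.carrier := fun x =>
        if h : e i x ≠ 0 then ⟨PB.et i x, PB.et_mem i x x.2 h⟩ else x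
      have ht (x : PB.carrier) (h : e i x ≠ 0) : (t x : V) = PB.et i x := by
        simp only [t, dif_pos h]
      rw [← hb]
      refine map_basis_eq_zero_of_mem_support (t := t) ?_ ?_
        ((Submodule.mem_iInf _).mp hv i) x hx
      · intro x hx y hy hxy
        simp only [Set.mem_ofPred_eq, hb] at hx hy
        refine Subtype.ext (PB.et_inj i x x.2 y y.2 hx hy ?_)
        rw [← ht x hx, ← ht y hy, hxy]
      · intro x hx
        rw [hb] at hx
        rw [hb, hb, ht x hx]
        exact PB.et_approx i x x.2 hx
    rw [← b.linearCombination_repr v, Finsupp.linearCombination_apply]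
    refine Submodule.sum_mem _ fun x hx => Submodule.smul_mem _ _ (Submodule.subset_span ?_)
    rw [hb]
    exact ⟨x.2, hker x hx⟩
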